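/- Let n ≥ 1 and 1 ≤ k ≤ n, and let α : {0,1}^n → ℝ with α_p = 0 whenever p = 0 or the Hamming weight |p| exceeds k, and suppose σ := (Σ_p α_p²)^{1/2} > 0. Define f : {0,1}^n → ℝ by f(s) = Σ_p α_p·(−1)^{s·p}, and I(τ) = (1/4^n)·Σ_{(s,t) ∈ {0,1}^n × {0,1}^n} cos((f(s) − f(t))·τ). Then the Lebesgue measure of the set {τ ∈ [0, 2/σ] : I(τ) ≤ 1 − 9^{−k}/16} is at least (1/3)·(2/σ). -/

import Mathlib

open MeasureTheory Classical

/-- Character. -/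
noncomputable def zchi {n : ℕ} (s p : Fin n → Bool) : ℝ :=
  ∏ j, (if s j = true ∧ p j = true then (-1 : ℝ) else 1)

/-- Hamming weight. -/
def zwt {n : ℕ} (p : Fin n → Bool) : ℕ := ∑ j, (if p j = true then 1 else 0)

/-- Walsh sum. -/
noncomputable def zF {n : ℕ} (α : (Fin n → Bool) → ℝ) (s : Fin n → Bool) : ℝ :=
  ∑ p, α p * zchi s p

lemma zsum_cons {n : ℕ} (g : (Fin (n+1) → Bool) → ℝ) :
    ∑ s, g s = ∑ s : Fin n → Bool, (g (Fin.cons false s) + g (Fin.cons true s)) := by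
  rw [← (Fin.consEquiv (fun _ : Fin (n+1) => Bool)).sum_comp, Fintype.sum_prod_type]
  simp [Fin.consEquiv, Finset.sum_add_distrib, add_comm]

lemma zF_cons_false {n : ℕ} (α : (Fin (n+1) → Bool) → ℝ) (s : Fin n → Bool) :
    zF α (Fin.cons false s) =
      zF (fun p => α (Fin.cons false p)) s + zF (fun p => α (Fin.cons true p)) s := by
  simp [zF, zsum_cons, zchi, Fin.prod_univ_succ, Finset.sum_add_distrib]

lemma zF_cons_true {n : ℕ} (α : (Fin (n+1) → Bool) → ℝ) (s : Fin n → Bool) :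
    zF α (Fin.cons true s) =
      zF (fun p => α (Fin.cons false p)) s - zF (fun p => α (Fin.cons true p)) s := by
  simp [zF, zsum_cons, zchi, Fin.prod_univ_succ, Finset.sum_add_distrib, sub_eq_add_neg]

lemma zF_mean {n : ℕ} (α : (Fin n → Bool) → ℝ) :
    ∑ s, zF α s = 2 ^ n * α (fun _ => false) := by
  induction n with
  | zero => simp [zF, zchi]; congr 1; exact Subsingleton.elim _ _
  | succ n ih =>
    simp only [zsum_cons, zF_cons_false, zF_cons_true]
    have : (Fin.cons false (fun _ : Fin n => false) : Fin (n+1) → Bool) = fun _ => false := by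
      funext j; refine Fin.cases ?_ (fun i => ?_) j <;> simp
    have h := ih (fun p => α (Fin.cons false p))
    simp only [this] at h
    rw [pow_succ, mul_right_comm, ← h, Finset.sum_mul]
    exact Finset.sum_congr rfl fun s _ => by ring

lemma zF_sq {n : ℕ} (α : (Fin n → Bool) → ℝ) :
    ∑ s, zF α s ^ 2 = 2 ^ n * ∑ p, α p ^ 2 := by
  induction n with
  | zero => simp [zF, zchi]
  | succ n ih =>
    simp only [zsum_cons, zF_cons_false, zF_cons_true]
    rw [Finset.sum_add_distrib, pow_succ]
    have h0 := ih (fun p => α (Fin.cons false p))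
    have h1 := ih (fun p => α (Fin.cons true p))
    calc _ = 2 * (∑ s, zF (fun p => α (Fin.cons false p)) s ^ 2
          + ∑ s, zF (fun p => α (Fin.cons true p)) s ^ 2) := by
          rw [← Finset.sum_add_distrib, ← Finset.sum_add_distrib, Finset.mul_sum]
          exact Finset.sum_congr rfl fun s _ => by ring
      _ = _ := by rw [h0, h1, Finset.sum_add_distrib]; ring

lemma zwt_cons {n : ℕ} (b : Bool) (p : Fin n → Bool) :
    zwt (Fin.cons b p : Fin (n+1) → Bool) = (if b = true then 1 else 0) + zwt p := by
  unfold zwt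
  rw [Fin.sum_univ_succ]
  simp only [Fin.cons_zero, Fin.cons_succ]

lemma zbonami {n : ℕ} : ∀ (k : ℕ) (α : (Fin n → Bool) → ℝ) (_ : ∀ p, k < zwt p → α p = 0),
    ∑ s, zF α s ^ 4 ≤ 2 ^ n * 9 ^ k * (∑ p, α p ^ 2) ^ 2 := by
  induction n with
  | zero =>
    intro k α _
    simp [zF, zchi]
    have h9 : (1:ℝ) ≤ 9 ^ k := one_le_pow₀ (by norm_num)
    nlinarith [sq_nonneg (α default ^ 2)]
  | succ n ih =>
    intro k α hα
    simp only [zsum_cons, zF_cons_false, zF_cons_true]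
    set a0 : (Fin n → Bool) → ℝ := fun p => α (Fin.cons false p) with ha0
    set a1 : (Fin n → Bool) → ℝ := fun p => α (Fin.cons true p) with ha1
    have h0 := ih k a0 (fun p hp => hα _ (by simpa [zwt_cons] using hp))
    set G := ∑ p, a0 p ^ 2 with hG
    set H := ∑ p, a1 p ^ 2 with hH
    have hG0 : 0 ≤ G := Finset.sum_nonneg fun _ _ => sq_nonneg _
    have hH0 : 0 ≤ H := Finset.sum_nonneg fun _ _ => sq_nonneg _
    have e : ∑ p, (α (Fin.cons false p) ^ 2 + α (Fin.cons true p) ^ 2) = G + H := by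
      rw [Finset.sum_add_distrib]
    rw [e]
    have e2 : ∑ s, ((zF a0 s + zF a1 s) ^ 4 + (zF a0 s - zF a1 s) ^ 4)
        = 2 * (∑ s, zF a0 s ^ 4) + 12 * (∑ s, zF a0 s ^ 2 * zF a1 s ^ 2)
          + 2 * (∑ s, zF a1 s ^ 4) := by
      rw [Finset.mul_sum, Finset.mul_sum, Finset.mul_sum, ← Finset.sum_add_distrib,
        ← Finset.sum_add_distrib]
      exact Finset.sum_congr rfl fun s _ => by ring
    rw [e2]
    cases k with
    | zero =>
      have hz : ∀ p, a1 p = 0 := fun p => hα _ (by rw [zwt_cons]; simp)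
      have hz1 : ∀ s, zF a1 s = 0 := fun s => by simp [zF, hz]
      have hH' : H = 0 := by simp [hH, hz]
      simp only [hz1, hH']
      simp only [pow_succ] at h0 ⊢
      simp
      simp at h0
      linarith
    | succ k =>
      have h1 := ih k a1 (fun p hp => hα _ (by rw [zwt_cons]; simp; omega))
      rw [← hH] at h1
      have cs := Finset.sum_mul_sq_le_sq_mul_sq Finset.univ
        (fun s => zF a0 s ^ 2) (fun s => zF a1 s ^ 2)
      simp only [← pow_mul] at cs
      norm_num at cs
      set X := ∑ s, zF a0 s ^ 2 * zF a1 s ^ 2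
      have hA0 : 0 ≤ ∑ s, zF a0 s ^ 4 := Finset.sum_nonneg fun _ _ => by positivity
      have hB0 : 0 ≤ ∑ s, zF a1 s ^ 4 := Finset.sum_nonneg fun _ _ => by positivity
      have hX : X ≤ 2 ^ n * 9 ^ k * 3 * (G * H) := by
        refine le_of_abs_le (abs_le_of_sq_le_sq ?_ (by positivity))
        calc X ^ 2 ≤ _ := cs
          _ ≤ (2 ^ n * 9 ^ (k+1) * G ^ 2) * (2 ^ n * 9 ^ k * H ^ 2) := by gcongr
          _ = _ := by ring
      have : 0 ≤ 2 ^ n * 9 ^ k * H ^ 2 := by positivity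
      rw [pow_succ] at h0 ⊢
      rw [pow_succ (9:ℝ)]
      nlinarith

lemma zint_lower (T D : ℝ) (hT : 0 < T) (hD : 0 < D) (hDT : 2 ≤ D * T) (B : Set ℝ)
    (hB : MeasurableSet B) (hBT : B ⊆ Set.Icc 0 T) (hm : 2 * T / 3 < volume.real B) :
    volume.real B / 4 < ∫ τ in B, (1 - Real.cos (D * τ)) := by
  have key : ∀ (w : ℝ → ℝ) (c : ℝ), Continuous w → (∀ τ, 0 ≤ w τ) → 1 / 4 < c →
      (∀ τ ∈ Set.Icc 0 T, c - w τ ≤ 1 - Real.cos (D * τ)) →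
      (∫ τ in (0:ℝ)..T, w τ) ≤ (2 * c / 3 - 1 / 6) * T →
      volume.real B / 4 < ∫ τ in B, (1 - Real.cos (D * τ)) := by
    intro w c hw hw0 hc hle hint
    have hwi : IntegrableOn w (Set.Icc 0 T) := hw.continuousOn.integrableOn_Icc
    have hfin : volume B ≠ ⊤ :=
      ne_top_of_le_ne_top (by simp) (measure_mono hBT)
    have hhi : IntegrableOn (fun τ => 1 - Real.cos (D * τ)) (Set.Icc 0 T) :=
      (by fun_prop : Continuous fun τ => 1 - Real.cos (D * τ)).continuousOn.integrableOn_Icc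
    have hci : IntegrableOn (fun _ : ℝ => c) B := by
      apply integrableOn_const hfin
    have h1 : ∫ τ in B, (c - w τ) ≤ ∫ τ in B, (1 - Real.cos (D * τ)) :=
      setIntegral_mono_on (hci.sub (hwi.mono_set hBT)) (hhi.mono_set hBT) hB
        (fun x hx => hle x (hBT hx))
    rw [integral_sub hci (hwi.mono_set hBT)] at h1
    have h2 : ∫ τ in B, w τ ≤ ∫ τ in Set.Icc 0 T, w τ :=
      setIntegral_mono_set hwi (Filter.Eventually.of_forall hw0) hBT.eventuallyLE
    rw [integral_Icc_eq_integral_Ioc, ← intervalIntegral.integral_of_le hT.le] at h2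
    simp only [setIntegral_const, smul_eq_mul] at h1
    nlinarith
  rcases le_or_gt Real.pi (D * T) with hpi | hpi
  · apply key (fun τ => (1 + Real.cos (D * τ)) ^ 2 / 3) (5/4) (by fun_prop)
      (fun τ => by positivity) (by norm_num)
    · intro τ _
      nlinarith [sq_nonneg (Real.cos (D * τ) - 1/2)]
    · have hd : ∀ x ∈ Set.uIcc 0 T, HasDerivAt
          (fun τ => (3 / 2 * τ + 2 * Real.sin (D * τ) / D
            + Real.sin (D * τ) * Real.cos (D * τ) / (2 * D)) / 3)
          ((1 + Real.cos (D * x)) ^ 2 / 3) x := by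
        intro x _
        have hl : HasDerivAt (fun τ => D * τ) D x := by
          simpa using (hasDerivAt_id x).const_mul D
        have hs := hl.sin
        have hc := hl.cos
        have := (((((hasDerivAt_id x).const_mul (3/2)).add
          ((hs.const_mul 2).div_const D)).add ((hs.mul hc).div_const (2*D))).div_const 3)
        refine this.congr_deriv ?_
        have := Real.sin_sq_add_cos_sq (D * x)
        field_simp
        linear_combination (-1) * this
      rw [intervalIntegral.integral_eq_sub_of_hasDerivAt hd
        ((by fun_prop : Continuous fun x => (1 + Real.cos (D * x)) ^ 2 / 3).intervalIntegrable _ _)]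
      simp only [mul_zero, Real.sin_zero, zero_div, zero_mul, add_zero, sub_zero]
      have hb : Real.sin (D * T) * (4 + Real.cos (D * T)) ≤ D * T := by
        rcases le_or_gt (D * T) (2 * Real.pi) with h | h
        · have : Real.sin (D * T) ≤ 0 := by
            have := Real.sin_nonneg_of_nonneg_of_le_pi (x := D * T - Real.pi)
              (by linarith) (by linarith)
            rw [Real.sin_sub_pi] at this
            linarith
          have := Real.neg_one_le_cos (D * T)
          nlinarith
        · have := Real.pi_gt_three
          have := Real.neg_one_le_cos (D * T)
          have := Real.cos_le_one (D * T)
          have := Real.sin_le_one (D * T)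
          nlinarith
      have : 2 * Real.sin (D * T) / D + Real.sin (D * T) * Real.cos (D * T) / (2 * D) ≤ T / 2 := by
        have e : 2 * Real.sin (D * T) / D + Real.sin (D * T) * Real.cos (D * T) / (2 * D)
          = Real.sin (D * T) * (4 + Real.cos (D * T)) / (2 * D) := by field_simp; ring
        rw [e, div_le_iff₀ (by positivity)]
        linarith
      linarith
  · have hpi4 := Real.pi_le_four
    have hc43 : Real.cos (4/3) < 1/2 := by
      rw [← Real.cos_pi_div_three]
      exact Real.cos_lt_cos_of_nonneg_of_le_pi (by positivity)
        (by linarith [Real.pi_gt_three]) (by linarith [Real.pi_lt_d2])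
    have hmono : ∀ a b : ℝ, 0 ≤ a → a ≤ b → b ≤ Real.pi → Real.cos b ≤ Real.cos a :=
      fun a b h1 h2 h3 => Real.cos_le_cos_of_nonneg_of_le_pi h1 h3 h2
    have hp3 := Real.pi_gt_three
    have hcw : Continuous (fun τ => max 0 (Real.cos (2 / T * τ) - Real.cos (4/3))) := by fun_prop
    apply key (fun τ => max 0 (Real.cos (2 / T * τ) - Real.cos (4/3))) (1 - Real.cos (4/3))
      hcw (fun τ => le_max_left _ _) (by linarith)
    · intro τ hτ
      have h2 : 2 / T * τ ≤ D * τ := by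
        apply mul_le_mul_of_nonneg_right _ hτ.1
        rw [div_le_iff₀ hT]; exact hDT
      have h3 : D * τ ≤ Real.pi := by nlinarith [hτ.2]
      have := hmono (2 / T * τ) (D * τ) (mul_nonneg (by positivity) hτ.1) h2 h3
      have := le_max_right 0 (Real.cos (2 / T * τ) - Real.cos (4/3))
      linarith
    · rw [← intervalIntegral.integral_add_adjacent_intervals (b := 2 * T / 3)
        (hcw.intervalIntegrable _ _) (hcw.intervalIntegrable _ _)]
      have i1 : ∫ τ in (0:ℝ)..(2 * T / 3), max 0 (Real.cos (2 / T * τ) - Real.cos (4/3))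
          = ∫ τ in (0:ℝ)..(2 * T / 3), (Real.cos (2 / T * τ) - Real.cos (4/3)) := by
        apply intervalIntegral.integral_congr
        intro τ hτ
        rw [Set.uIcc_of_le (by positivity)] at hτ
        apply max_eq_right
        have : 2 / T * τ ≤ 4/3 := by
          rw [div_mul_eq_mul_div, div_le_iff₀ hT]; linarith [hτ.2]
        linarith [hmono (2 / T * τ) (4/3) (mul_nonneg (by positivity) hτ.1) this (by linarith)]
      have i2 : ∫ τ in (2 * T / 3)..T, max 0 (Real.cos (2 / T * τ) - Real.cos (4/3))
          = ∫ τ in (2 * T / 3)..T, (0:ℝ) := by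
        apply intervalIntegral.integral_congr
        intro τ hτ
        rw [Set.uIcc_of_le (by linarith)] at hτ
        apply max_eq_left
        have : 4/3 ≤ 2 / T * τ := by
          rw [div_mul_eq_mul_div, le_div_iff₀ hT]; linarith [hτ.1]
        have h3 : 2 / T * τ ≤ 2 := by
          rw [div_mul_eq_mul_div, div_le_iff₀ hT]; linarith [hτ.2]
        linarith [hmono (4/3) (2 / T * τ) (by norm_num) this (by linarith)]
      have hd : ∀ x ∈ Set.uIcc 0 (2 * T / 3), HasDerivAt
          (fun τ => Real.sin (2 / T * τ) * (T / 2) - Real.cos (4/3) * τ)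
          (Real.cos (2 / T * x) - Real.cos (4/3)) x := by
        intro x _
        have hl : HasDerivAt (fun τ => 2 / T * τ) (2 / T) x := by
          simpa using (hasDerivAt_id x).const_mul (2 / T)
        have := (hl.sin.mul_const (T/2)).sub ((hasDerivAt_id x).const_mul (Real.cos (4/3)))
        refine this.congr_deriv ?_
        field_simp
      rw [i1, i2, intervalIntegral.integral_eq_sub_of_hasDerivAt hd
        ((by fun_prop : Continuous fun x =>
          Real.cos (2 / T * x) - Real.cos (4/3)).intervalIntegrable _ _)]
      simp only [mul_zero, Real.sin_zero, zero_mul, sub_zero, intervalIntegral.integral_zero,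
        add_zero]
      have := Real.sin_le_one (2 / T * (2 * T / 3))
      nlinarith

lemma zint_lower_abs (T D : ℝ) (hT : 0 < T) (hDT : 2 ≤ |D| * T) (B : Set ℝ)
    (hB : MeasurableSet B) (hBT : B ⊆ Set.Icc 0 T) (hm : 2 * T / 3 < volume.real B) :
    volume.real B / 4 < ∫ τ in B, (1 - Real.cos (D * τ)) := by
  have hD : 0 < |D| := by
    by_contra h
    nlinarith
  have := zint_lower T |D| hT hD hDT B hB hBT hm
  rcases abs_choice D with h | h
  · rwa [h] at this
  · rw [h] at this
    simpa only [neg_mul, Real.cos_neg] using this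

lemma zPZ {ι : Type*} [Fintype ι] (D : ι → ℝ) (σ N K : ℝ) (hσ : 0 < σ) (hN : 0 < N)
    (hcard : (Fintype.card ι : ℝ) = N) (hK : 0 < K)
    (h2 : ∑ i, D i ^ 2 = 2 * σ ^ 2 * N) (h4 : ∑ i, D i ^ 4 ≤ 4 * K * σ ^ 4 * N) :
    N / (4 * K) ≤ ((Finset.univ.filter (fun i => σ ≤ |D i|)).card : ℝ) := by
  classical
  set S := Finset.univ.filter (fun i => σ ≤ |D i|) with hS
  have hsplit := Finset.sum_filter_add_sum_filter_not Finset.univ (fun i => σ ≤ |D i|)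
    (fun i => D i ^ 2)
  have hnot : ∑ i ∈ Finset.univ.filter (fun i => ¬ σ ≤ |D i|), D i ^ 2 ≤ σ ^ 2 * N := by
    calc _ ≤ ∑ i ∈ Finset.univ.filter (fun i => ¬ σ ≤ |D i|), σ ^ 2 := by
          apply Finset.sum_le_sum
          intro i hi
          simp only [Finset.mem_filter, not_le] at hi
          rw [← sq_abs]
          exact pow_le_pow_left₀ (abs_nonneg _) hi.2.le 2
      _ ≤ ∑ i : ι, σ ^ 2 := Finset.sum_le_sum_of_subset_of_nonneg (Finset.filter_subset _ _)
          (fun _ _ _ => sq_nonneg _)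
      _ = σ ^ 2 * N := by simp [hcard, mul_comm]
  have hlow : σ ^ 2 * N ≤ ∑ i ∈ S, D i ^ 2 := by linarith
  have cs := sq_sum_le_card_mul_sum_sq (s := S) (f := fun i => D i ^ 2)
  simp only [← pow_mul] at cs
  norm_num at cs
  have h4' : ∑ i ∈ S, D i ^ 4 ≤ 4 * K * σ ^ 4 * N :=
    (Finset.sum_le_sum_of_subset_of_nonneg (Finset.subset_univ _)
      (fun _ _ _ => by positivity)).trans h4
  have hsq : (σ ^ 2 * N) ^ 2 ≤ (S.card : ℝ) * (4 * K * σ ^ 4 * N) :=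
    (pow_le_pow_left₀ (by positivity) hlow 2).trans
      (cs.trans (mul_le_mul_of_nonneg_left h4' (by positivity)))
  rw [div_le_iff₀ (by positivity)]
  have : (σ ^ 4 * N) * N ≤ (σ ^ 4 * N) * ((S.card : ℝ) * (4 * K)) := by nlinarith
  exact le_of_mul_le_mul_left this (by positivity)

lemma zmoments {n : ℕ} (f : (Fin n → Bool) → ℝ) (M2 M3 M4 : ℝ) (h1 : ∑ s, f s = 0)
    (h2 : ∑ s, f s ^ 2 = M2) (h3 : ∑ s, f s ^ 3 = M3) (h4 : ∑ s, f s ^ 4 = M4) :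
    ∑ st : (Fin n → Bool) × (Fin n → Bool), (f st.1 - f st.2) ^ 2 = 2 * 2 ^ n * M2 ∧
    ∑ st : (Fin n → Bool) × (Fin n → Bool), (f st.1 - f st.2) ^ 4
      = 2 * 2 ^ n * M4 + 6 * M2 ^ 2 := by
  constructor
  · have e : ∀ s t, (f s - f t) ^ 2 = f s ^ 2 + (-2 * f s) * f t + f t ^ 2 := by intros; ring
    simp only [Fintype.sum_prod_type, e, Finset.sum_add_distrib, ← Finset.mul_sum, h1, h2]
    simp [← Finset.mul_sum, h2]
    ring
  · have e : ∀ s t, (f s - f t) ^ 4 = f s ^ 4 + (-4 * f s ^ 3) * f t + (6 * f s ^ 2) * f t ^ 2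
        + (-4 * f s) * f t ^ 3 + f t ^ 4 := by intros; ring
    simp only [Fintype.sum_prod_type, e, Finset.sum_add_distrib, ← Finset.mul_sum,
      ← Finset.sum_mul, h1, h2, h3, h4]
    simp [← Finset.mul_sum, h4]
    ring


/-- **Optimal-time certification guarantee for diagonal `k`-local Hamiltonians.**
Let `f(s) = ∑_p α_p (−1)^{s·p}` with `α_0 = 0`, `α_p = 0` for Hamming weight
`|p| > k`, and `σ := (∑_p α_p²)^{1/2} > 0` (the normalized Frobenius norm of the
corresponding `Z`-diagonal Hamiltonian). Then the set of times
`τ ∈ [0, 2/σ]` at which the Bell-sampling identity-outcome probability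
`I(τ) = 4^{−n} ∑_{s,t} cos((f(s) − f(t)) τ)` drops below `1 − 9^{−k}/16`
has Lebesgue measure at least `(1/3)·(2/σ)`. -/
theorem zdiag_certification_measure
    (n k : ℕ) (hn : 1 ≤ n) (hk1 : 1 ≤ k) (hkn : k ≤ n)
    (α : (Fin n → Bool) → ℝ)
    (hzero : α (fun _ => false) = 0)
    (hloc : ∀ p : Fin n → Bool,
      k < (Finset.univ.filter (fun j => p j = true)).card → α p = 0)
    (f : (Fin n → Bool) → ℝ)
    (hf : ∀ s, f s = ∑ p, α p * (-1 : ℝ) ^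
      (Finset.univ.filter (fun j => s j = true ∧ p j = true)).card)
    (hσ : 0 < Real.sqrt (∑ p, (α p) ^ 2)) :
    ENNReal.ofReal ((1 / 3) * (2 / Real.sqrt (∑ p, (α p) ^ 2))) ≤
      volume {τ ∈ Set.Icc (0 : ℝ) (2 / Real.sqrt (∑ p, (α p) ^ 2)) |
        (1 / 4 ^ n : ℝ) * ∑ st : (Fin n → Bool) × (Fin n → Bool),
            Real.cos ((f st.1 - f st.2) * τ) ≤ 1 - 1 / (16 * 9 ^ k)} := by
  set Q := ∑ p, (α p) ^ 2 with hQ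
  set σ := Real.sqrt Q with hσd
  have hQ0 : 0 ≤ Q := Finset.sum_nonneg fun _ _ => sq_nonneg _
  have hσ2 : σ ^ 2 = Q := Real.sq_sqrt hQ0
  have hfF : f = zF α := by
    funext s
    rw [hf, zF]
    refine Finset.sum_congr rfl fun p _ => ?_
    rw [zchi, Finset.prod_ite]
    simp
  have hloc' : ∀ p, k < zwt p → α p = 0 := by
    intro p hp
    apply hloc
    rw [zwt, ← Finset.card_filter] at hp
    exact hp
  have m1 : ∑ s, f s = 0 := by rw [hfF, zF_mean, hzero, mul_zero]
  have m2 : ∑ s, f s ^ 2 = 2 ^ n * Q := by rw [hfF, zF_sq]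
  have m4 : ∑ s, f s ^ 4 ≤ 2 ^ n * 9 ^ k * Q ^ 2 := by rw [hfF]; exact zbonami k α hloc'
  obtain ⟨d2, d4⟩ := zmoments f _ _ _ m1 m2 rfl rfl
  have h4n : (4:ℝ) ^ n = 2 ^ n * 2 ^ n := by rw [← mul_pow]; norm_num
  have h9 : (9:ℝ) ≤ 9 ^ k := by
    simpa using pow_le_pow_right₀ (by norm_num : (1:ℝ) ≤ 9) hk1
  have hPZ := zPZ (fun st : (Fin n → Bool) × (Fin n → Bool) => f st.1 - f st.2) σ (4 ^ n) (9 ^ k)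
    hσ (by positivity) (by simp [h4n]) (by positivity)
    (by rw [d2, hσ2, h4n]; ring)
    (by
      rw [d4, show σ ^ 4 = (σ ^ 2) ^ 2 by ring, hσ2, h4n]
      have a1 : 2 * 2 ^ n * ∑ s, f s ^ 4 ≤ 2 * 2 ^ n * (2 ^ n * 9 ^ k * Q ^ 2) :=
        mul_le_mul_of_nonneg_left m4 (by positivity)
      have a2 : (2 ^ n * Q) ^ 2 * 9 ≤ (2 ^ n * Q) ^ 2 * 9 ^ k :=
        mul_le_mul_of_nonneg_left h9 (by positivity)
      nlinarith [sq_nonneg ((2:ℝ) ^ n * Q)])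
  set S := Finset.univ.filter
    (fun st : (Fin n → Bool) × (Fin n → Bool) => σ ≤ |f st.1 - f st.2|) with hS
  set T := 2 / σ with hT
  have hT0 : 0 < T := by positivity
  set A := {τ ∈ Set.Icc (0 : ℝ) T |
        (1 / 4 ^ n : ℝ) * ∑ st : (Fin n → Bool) × (Fin n → Bool),
            Real.cos ((f st.1 - f st.2) * τ) ≤ 1 - 1 / (16 * 9 ^ k)} with hA
  have hAm : MeasurableSet A := by
    apply MeasurableSet.inter measurableSet_Icc
    exact measurableSet_le (f := fun τ : ℝ => (1 / 4 ^ n : ℝ) *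
      ∑ st : (Fin n → Bool) × (Fin n → Bool), Real.cos ((f st.1 - f st.2) * τ))
      (by fun_prop) measurable_const
  have hAsub : A ⊆ Set.Icc 0 T := fun x hx => hx.1
  have hAfin : volume A ≠ ⊤ := ne_top_of_le_ne_top (by simp) (measure_mono hAsub)
  by_contra hlt
  rw [not_le, ENNReal.lt_ofReal_iff_toReal_lt hAfin] at hlt
  change volume.real A < _ at hlt
  set B := Set.Icc 0 T \ A with hB
  have hBm : MeasurableSet B := measurableSet_Icc.diff hAm
  have hBT : B ⊆ Set.Icc 0 T := Set.sdiff_subset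
  have hBv : volume.real B = T - volume.real A := by
    rw [hB, measureReal_sdiff hAsub hAm (by simp)]
    simp [hT0.le]
  have hBl : 2 * T / 3 < volume.real B := by rw [hBv]; linarith
  have hBfin : volume B ≠ ⊤ := ne_top_of_le_ne_top (by simp) (measure_mono hBT)
  have hint : ∀ D : ℝ, IntegrableOn (fun τ => 1 - Real.cos (D * τ)) B := fun D =>
    ((by fun_prop : Continuous fun τ => 1 - Real.cos (D * τ)).continuousOn.integrableOn_Icc
      (a := 0) (b := T)).mono_set hBT
  have hup : ∫ τ in B, ∑ st ∈ S, (1 - Real.cos ((f st.1 - f st.2) * τ))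
      ≤ ∫ τ in B, (4 ^ n / (16 * 9 ^ k) : ℝ) := by
    apply setIntegral_mono_on (integrable_finsetSum _ fun st _ => hint _)
      (integrableOn_const hBfin) hBm
    intro τ hτ
    have hτ' : 1 - 1 / (16 * 9 ^ k) < (1 / 4 ^ n : ℝ) *
        ∑ st : (Fin n → Bool) × (Fin n → Bool), Real.cos ((f st.1 - f st.2) * τ) := by
      by_contra h
      exact hτ.2 ⟨hτ.1, not_lt.mp h⟩
    calc _ ≤ ∑ st : (Fin n → Bool) × (Fin n → Bool), (1 - Real.cos ((f st.1 - f st.2) * τ)) :=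
          Finset.sum_le_sum_of_subset_of_nonneg (Finset.subset_univ _)
            (fun st _ _ => by linarith [Real.cos_le_one ((f st.1 - f st.2) * τ)])
      _ = 4 ^ n - ∑ st : (Fin n → Bool) × (Fin n → Bool), Real.cos ((f st.1 - f st.2) * τ) := by
          rw [Finset.sum_sub_distrib]
          simp [h4n]
      _ ≤ _ := by
          have h4p : (0:ℝ) < 4 ^ n := by positivity
          have := mul_lt_mul_of_pos_left hτ' h4p
          rw [← mul_assoc, mul_one_div_cancel h4p.ne', one_mul, mul_sub, mul_one,
            mul_one_div] at this
          linarith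
  rw [integral_finsetSum _ fun st _ => hint _, setIntegral_const, smul_eq_mul] at hup
  have hScard : (0:ℝ) < S.card := lt_of_lt_of_le (by positivity) hPZ
  have hSne : S.Nonempty := Finset.card_pos.mp (by exact_mod_cast hScard)
  have hlow : ∑ st ∈ S, volume.real B / 4
      < ∑ st ∈ S, ∫ τ in B, (1 - Real.cos ((f st.1 - f st.2) * τ)) := by
    apply Finset.sum_lt_sum_of_nonempty hSne
    intro st hst
    have hst' : σ ≤ |f st.1 - f st.2| := (Finset.mem_filter.mp hst).2
    apply zint_lower_abs T _ hT0 _ B hBm hBT hBl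
    have : σ * T = 2 := by rw [hT]; field_simp
    nlinarith
  rw [Finset.sum_const, nsmul_eq_mul] at hlow
  have hfin := mul_le_mul_of_nonneg_right hPZ (by linarith : 0 ≤ volume.real B / 4)
  have e : (4:ℝ) ^ n / (4 * 9 ^ k) * (volume.real B / 4)
      = volume.real B * (4 ^ n / (16 * 9 ^ k)) := by
    field_simp; ring
  linarith
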